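/- Let W be the group of ℚ-linear automorphisms g of ℚ^8 that preserve the standard dot product and satisfy g(Λ) = Λ, where Λ is the E8 lattice. Let 𝒞 be the set of 8-element subsets S of the set of roots of the E8 lattice such that r · s ∈ {0, −1} for all distinct r, s ∈ S. Then the natural action of W on 𝒞 has exactly 47 orbits. -/

import Mathlib

/-- The standard dot product on `ℚ^8`. -/
def E8dot (v w : Fin 8 → ℚ) : ℚ := ∑ i, v i * w i

/-- Membership in the E8 lattice. -/
def InE8 (v : Fin 8 → ℚ) : Prop :=
  ((∀ i, ∃ n : ℤ, v i = n) ∨ (∀ i, ∃ n : ℤ, v i - 1/2 = n)) ∧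
    (∃ n : ℤ, ∑ i, v i = 2 * n)

/-- A root of the E8 lattice: a lattice vector of squared length 2. -/
def IsE8Root (r : Fin 8 → ℚ) : Prop := InE8 r ∧ E8dot r r = 2

/-- Membership in the Weyl group `W`: a `ℚ`-linear automorphism of `ℚ^8` preserving
the standard dot product and mapping the E8 lattice onto itself. -/
def InW (g : (Fin 8 → ℚ) ≃ₗ[ℚ] (Fin 8 → ℚ)) : Prop :=
  (∀ v w, E8dot (g v) (g w) = E8dot v w) ∧ (⇑g '' {v | InE8 v} = {v | InE8 v})

/-- An 8-element set of E8 roots pairwise meeting with dot product 0 or -1. -/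
def IsRootClique8 (S : Finset (Fin 8 → ℚ)) : Prop :=
  S.card = 8 ∧ (∀ r ∈ S, IsE8Root r) ∧
    ∀ r ∈ S, ∀ s ∈ S, r ≠ s → (E8dot r s = 0 ∨ E8dot r s = -1)

namespace E8

/-- An integer vector with eight coordinates; it stands for its half in `ℚ^8`. -/
@[ext] structure Vec where
  (x0 x1 x2 x3 x4 x5 x6 x7 : ℤ)
deriving DecidableEq

namespace Vec

/-- The vector whose coordinates, each increased by two, are the decimal digits of `n`. -/
def ofCode (n : ℕ) : Vec :=
  ⟨digit 10000000, digit 1000000, digit 100000, digit 10000, digit 1000, digit 100, digit 10,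
    digit 1⟩
where
  digit (p : ℕ) : ℤ := Int.subNatNat (n / p % 10) 2

/-- The rational vector represented by `v`. -/
def toRat (v : Vec) : Fin 8 → ℚ :=
  ![v.x0 / 2, v.x1 / 2, v.x2 / 2, v.x3 / 2, v.x4 / 2, v.x5 / 2, v.x6 / 2, v.x7 / 2]

/-- Four times the dot product of the represented vectors. -/
def dot (v w : Vec) : ℤ :=
  v.x0 * w.x0 + v.x1 * w.x1 + v.x2 * w.x2 + v.x3 * w.x3 + v.x4 * w.x4 + v.x5 * w.x5 +
    v.x6 * w.x6 + v.x7 * w.x7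

/-- The vector `v + k w`. -/
def addMul (v : Vec) (k : ℤ) (w : Vec) : Vec :=
  ⟨v.x0 + k * w.x0, v.x1 + k * w.x1, v.x2 + k * w.x2, v.x3 + k * w.x3, v.x4 + k * w.x4,
    v.x5 + k * w.x5, v.x6 + k * w.x6, v.x7 + k * w.x7⟩

/-- The image of `v` under the reflection in the root `r`. -/
def reflect (r v : Vec) : Vec := v.addMul (-(r.dot v / 4)) r

/-- The images of `v` under the successive reflections in the members of `w`. -/
def reflectAll (w : List Vec) (v : Vec) : Vec := w.foldl (fun u r => reflect r u) v

/-- All coordinates of `v` are congruent to `e` modulo two. -/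
def hasParity (e : ℤ) (v : Vec) : Bool :=
  v.x0 % 2 == e && v.x1 % 2 == e && v.x2 % 2 == e && v.x3 % 2 == e && v.x4 % 2 == e &&
    v.x5 % 2 == e && v.x6 % 2 == e && v.x7 % 2 == e

/-- The vector represents a root. -/
def isRoot (v : Vec) : Bool :=
  v.dot v == 8 && (v.x0 + v.x1 + v.x2 + v.x3 + v.x4 + v.x5 + v.x6 + v.x7) % 4 == 0 &&
    (hasParity 0 v || hasParity 1 v)

/-- The quadruples with entries in `l` and sum of squares at most eight. -/
def quadruples (l : List ℤ) : List (ℤ × ℤ × ℤ × ℤ) :=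
  (l.flatMap fun a => l.flatMap fun b => l.flatMap fun c => l.map fun d => (a, b, c, d)).filter
    fun q => decide (q.1 * q.1 + q.2.1 * q.2.1 + q.2.2.1 * q.2.2.1 + q.2.2.2 * q.2.2.2 ≤ 8)

/-- The vectors with coordinates in `l` both halves of which have sum of squares at most eight. -/
def box (l : List ℤ) : List Vec :=
  (quadruples l).flatMap fun p => (quadruples l).map fun q =>
    ⟨p.1, p.2.1, p.2.2.1, p.2.2.2, q.1, q.2.1, q.2.2.1, q.2.2.2⟩

end Vec

open Vec

/-- All roots. -/
def rootList : List Vec := (box [-1, 1] ++ box [-2, 0, 2]).filter isRoot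

/-- A system of simple roots. -/
def simpleRoots : List Vec :=
  [⟨1, -1, -1, -1, -1, -1, -1, 1⟩, ⟨2, 2, 0, 0, 0, 0, 0, 0⟩, ⟨-2, 2, 0, 0, 0, 0, 0, 0⟩,
    ⟨0, -2, 2, 0, 0, 0, 0, 0⟩, ⟨0, 0, -2, 2, 0, 0, 0, 0⟩, ⟨0, 0, 0, -2, 2, 0, 0, 0⟩,
    ⟨0, 0, 0, 0, -2, 2, 0, 0⟩, ⟨0, 0, 0, 0, 0, -2, 2, 0⟩]

/-- A vector having positive dot product with all simple roots. -/
def weylVector : Vec := ⟨0, 2, 4, 6, 8, 10, 12, 46⟩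

/-- The root `r` extends the clique `T`, it is dominant for the simple roots orthogonal to `T`,
and it has minimal degree in the extended clique. -/
def isExtension (T : List Vec) (r : Vec) : Bool :=
  (T.all fun t => t.dot r == 0 || t.dot r == -4) &&
    (simpleRoots.all fun a => decide (0 ≤ a.dot r) || T.any fun t => a.dot t != 0) &&
    T.all fun t => decide (((r :: T).map t.dot).sum ≤ ((r :: T).map r.dot).sum)

/-- The reflections `c.2` map the clique `r :: T` onto the clique with index `c.1` in `L`. -/
def isLink (k : ℕ) (L : List (List Vec)) (T : List Vec) (r : Vec) (c : ℕ × List Vec) : Bool :=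
  match L[c.1]? with
  | none => false
  | some T' => c.2.all isRoot && decide (T'.length ≤ k + 1) &&
      (r :: T).all fun x => decide (reflectAll c.2 x ∈ T')

/-- Every root in the list is linked to `L` by the corresponding certificate. -/
def allLinked (k : ℕ) (L : List (List Vec)) (T : List Vec) :
    List Vec → List (ℕ × List Vec) → Bool
  | [], _ => true
  | _ :: _, [] => false
  | r :: rs, c :: cs => isLink k L T r c && allLinked k L T rs cs

/-- For each size, representatives of the orbits of cliques of this size. Each representative is
followed by one certificate per admissible extension: the index of the representative of the
extended clique, and the roots of reflections mapping the extended clique onto it. -/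
def cliqueTable : List (List (List ℕ × List (ℕ × List ℕ))) := [
  [
    ([], [(0, [])])],
  [
    ([22222244], [(1, []), (0, [])])],
  [
    ([22222244, 22222402], [(2, []), (0, [22224242, 33331133, 33333311]), (1, []), (0, [])]),
    ([22222244, 22222204], [(3, [])])],
  [
    ([22222244, 22222402, 22224022], [(3, []), (0, [33311333, 33313111]), (1, []), (2, []),
      (0, [])]),
    ([22222244, 22222402, 22222020], [(4, [])]),
    ([22222244, 22222402, 33333113], [(6, []), (5, [])]),
    ([22222244, 22222204, 22224422], [(8, []), (7, [])])],
  [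
    ([22222244, 22222402, 22224022, 22240222], [(0, [42222022, 33111313, 31313333, 31331311]),
      (3, []), (1, [42222422, 33333131, 31113133, 31131111]), (1, []), (2, []), (0, [])]),
    ([22222244, 22222402, 22224022, 22220022], [
      (1, [31131133, 31133311, 22242220, 22242422, 22240222, 22244222]),
      (1, [22242422, 22222424, 33311311, 33333131]), (5, []),
      (1, [22244222, 22224022, 22222424, 22222402]), (4, [])]),
    ([22222244, 22222402, 22224022, 22220220], [(6, [])]),
    ([22222244, 22222402, 22224022, 13331113], [(9, []), (7, []), (8, [])]),
    ([22222244, 22222402, 22222020, 33333113], [(11, []), (10, [])]),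
    ([22222244, 22222402, 33333113, 222222], [(12, [42224222, 33311113, 24242222]),
      (7, [31113133, 33331133, 24220222, 42222202, 40222222, 44222222]),
      (7, [33113333, 33331133, 22224022, 42220222, 42224222]),
      (7, [42422222, 42220222, 42022222]), (12, []),
      (7, [31311133, 31333111, 24222202, 24242222, 42222422, 42220222])]),
    ([22222244, 22222402, 33333113, 11113113], [(13, [])]),
    ([22222244, 22222204, 22224422, 22442222], [(14, [42222202, 42222242]),
      (14, [33311113, 33313331]), (14, [33113113, 33333131]), (14, [])]),
    ([22222244, 22222204, 22224422, 22220422], [(14, [33113113, 33333131])])],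
  [
    ([22222244, 22222402, 22224022, 22240222, 22402222], [(5, []),
      (2, [31311111, 31113313, 31131133]), (1, [31311111, 31113313, 31131133]), (4, []), (2, []),
      (3, []), (1, []), (0, [])]),
    ([22222244, 22222402, 22224022, 22240222, 22200222], [(4, [42242222, 33133331, 42202222]),
      (4, [33133331]), (7, []), (2, [22422220, 22422242, 22422422, 22424222, 22442222]), (6, [])]),
    ([22222244, 22222402, 22224022, 22240222, 22202220], [(8, [])]),
    ([22222244, 22222402, 22224022, 22240222, 33311113], [(9, [44222222, 31111113, 24422222]),
      (9, []), (10, [])]),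
    ([22222244, 22222402, 22224022, 22220022, 22442222], [(11, [42220222, 42224222]),
      (11, [33311333, 33313111]), (12, []), (11, [])]),
    ([22222244, 22222402, 22224022, 22220022, 22222240], [(13, [])]),
    ([22222244, 22222402, 22224022, 22220220, 13331113], [(16, []), (14, []), (15, [])]),
    ([22222244, 22222402, 22224022, 13331113, 40222222], [(19, [40222222, 31111113, 22442222]),
      (9, [42242222, 42202222, 31331333, 31333111]), (12, [40222222, 33133331, 42022222]),
      (18, [42202222, 31333331, 24422222]), (9, [44222222, 42242222, 33131113, 24422222]),
      (19, []), (9, [42422222, 42202222, 42022222]), (17, [33311333, 33313111]),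
      (9, [31331113, 22222442, 22224220, 42022222, 42422222, 44222222]), (18, []), (17, [])]),
    ([22222244, 22222402, 22224022, 13331113, 42242222], [(20, [31333331, 42022222]), (20, [])]),
    ([22222244, 22222402, 22224022, 13331113, 31111113], [(20, [31333331, 42022222])]),
    ([22222244, 22222402, 22222020, 33333113, 222222], [(22, [42224222, 33311113, 24242222]),
      (23, []), (21, [42224222, 33311113, 24242222]), (22, []), (21, [])]),
    ([22222244, 22222402, 22222020, 33333113, 11113113], [(24, [])]),
    ([22222244, 22222402, 33333113, 222222, 22024222], [(26, []), (25, [22240222, 22402222]),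
      (25, [])]),
    ([22222244, 22222402, 33333113, 11113113, 2242222], [(27, [])]),
    ([22222244, 22222204, 22224422, 22442222, 44222222], [(28, []), (28, [24202222, 42022222]),
      (28, [24222022, 42220222])])],
  [
    ([22222244, 22222402, 22224022, 22240222, 22402222, 44222222], [(0, [])]),
    ([22222244, 22222402, 22224022, 22240222, 22402222, 24022222], [
      (1, [42224222, 33311131, 31331333, 33131311]),
      (5, [42224222, 33311131, 31331333, 33131311]), (6, []),
      (3, [42224222, 33311131, 31331333, 33131311]), (5, []), (2, []), (3, []), (4, []), (1, []),
      (2, [42224222, 33311131, 31331333, 33131311])]),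
    ([22222244, 22222402, 22224022, 22240222, 22402222, 22002222], [
      (5, [42422222, 31333331, 42022222]), (5, [31333331]), (7, [42022222, 42422222]), (8, []),
      (3, [24222220, 24222242, 24222422, 24224222, 24242222, 24422222]), (7, [])]),
    ([22222244, 22222402, 22224022, 22240222, 22402222, 22022220], [(10, []), (9, [])]),
    ([22222244, 22222402, 22224022, 22240222, 22402222, 33111331], [
      (5, [31331333, 33133313, 33313133, 22244222, 22422422, 24242222, 42222202, 44222222]),
      (12, []), (11, []), (5, [31331333, 33133313, 33313133, 24220222, 44222222])]),
    ([22222244, 22222402, 22224022, 22240222, 22402222, 13111113], [(13, [31111113, 40222222]),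
      (13, []), (0, [])]),
    ([22222244, 22222402, 22224022, 22240222, 22200222, 24422222], [(14, [42202222, 42242222]),
      (15, []), (14, [])]),
    ([22222244, 22222402, 22224022, 22240222, 22200222, 22222240], [(16, [])]),
    ([22222244, 22222402, 22224022, 22240222, 22202220, 33311113], [
      (17, [44222222, 31111113, 24422222]), (17, []), (18, [])]),
    ([22222244, 22222402, 22224022, 22240222, 33311113, 222222], [
      (14, [31333331, 22224242, 22242220, 42222022, 42222422, 44222222]),
      (14, [42242222, 31111113, 42202222]), (20, [44222222, 40222222, 31333331, 42422222]),
      (19, []), (13, [42022222, 42422222]),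
      (13, [31113133, 31131111, 33111313, 24222022, 42022222, 44222222]), (20, [])]),
    ([22222244, 22222402, 22224022, 22240222, 33311113, 2422222], []),
    ([22222244, 22222402, 22224022, 22220022, 22442222, 44222222], [(21, []),
      (21, [24202222, 42022222])]),
    ([22222244, 22222402, 22224022, 22220022, 22442222, 24022222], [
      (14, [33331133, 33333311, 22242220, 22242422, 24220222, 24224222, 42422222]),
      (14, [31331311, 31333133, 22422220, 22422422, 22402222, 40222222]),
      (14, [31331311, 31333133, 22422224, 22422022, 22402222, 40222222]),
      (14, [33331133, 33333311, 22242224, 22242022, 24220222, 24224222, 42422222]),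
      (22, [42220222, 42224222]), (22, [40222222, 24242222, 24022222]),
      (14, [42222224, 42222202, 42222022, 42220222, 42202222, 42022222, 40222222]),
      (22, [42422222, 33111111, 33113333]), (23, []), (22, [31131111, 31133333]), (22, []),
      (22, [24202222, 22420222, 22424222]),
      (14, [42222220, 42222242, 42222422, 42224222, 42202222, 42022222, 40222222])]),
    ([22222244, 22222402, 22224022, 22220022, 22222240, 22442222], [(24, [42220222, 42224222]),
      (24, [33311113, 33313331]), (23, []), (24, [])]),
    ([22222244, 22222402, 22224022, 22220220, 13331113, 40222222], [(28, []),
      (27, [40222222, 31111113, 22442222]), (26, [42202222, 31333331, 24422222]), (27, []),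
      (25, [33311131, 33313313]), (26, []), (25, [])]),
    ([22222244, 22222402, 22224022, 22220220, 13331113, 42242222], [(29, [31333331, 42022222]),
      (29, [])]),
    ([22222244, 22222402, 22224022, 22220220, 13331113, 31111113], [(29, [31333331, 42022222])]),
    ([22222244, 22222402, 22224022, 13331113, 40222222, 44222222], [(30, [])]),
    ([22222244, 22222402, 22224022, 13331113, 40222222, 24022222], [
      (20, [42242222, 42202222, 31111333, 31113111]),
      (22, [42422222, 24224222, 31333331, 24220222]),
      (20, [31133131, 31311133, 33111111, 22240222, 42202222, 42242222]),
      (22, [31113133, 31331131, 33133111, 22222442, 24022222, 40222222]),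
      (22, [24202222, 22242220, 31311111, 31333331]),
      (20, [31111311, 31131133, 22224422, 22420222, 24202222, 42222220, 40222222, 44222222]),
      (20, [42422222, 42022222, 31111113, 22442222]),
      (20, [33311113, 33333333, 22422202, 24222022, 42220222, 42422222, 40222222, 44222222]),
      (22, [31111131, 31333133, 33131333, 24202222, 24242222, 42422222]),
      (20, [42202222, 42242222]),
      (20, [31331333, 31333111, 33133331, 24422222, 42242222, 44222222]),
      (20, [33331111, 22424222, 24222422, 42222242, 42202222, 42242222])]),
    ([22222244, 22222402, 22224022, 13331113, 40222222, 22002222], [(22, [33133331, 22442222]),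
      (22, [31111311, 31331333, 33131131, 22224422, 22442222]), (31, [24202222, 42422222]),
      (31, [])]),
    ([22222244, 22222402, 22224022, 13331113, 42242222, 20422222], [(32, [])]),
    ([22222244, 22222402, 22222020, 33333113, 222222, 24022222], [(35, [31331113, 22424222]),
      (33, [31331113, 22424222]),
      (28, [31131111, 33113311, 33133133, 22422022, 24242222, 42222220]),
      (33, [22422022, 31133131, 31333313]), (35, []), (33, [22224422, 31131313, 31133131]),
      (33, []), (34, [])]),
    ([22222244, 22222402, 22222020, 33333113, 222222, 22024222], [(37, []),
      (36, [22240222, 22402222]), (36, [])]),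
    ([22222244, 22222402, 22222020, 33333113, 222222, 33111331], [
      (38, [42202222, 33133331, 24220222]), (38, [])]),
    ([22222244, 22222402, 22222020, 33333113, 11113113, 2242222], [(39, [])]),
    ([22222244, 22222402, 33333113, 222222, 22024222, 22402222], [(40, [])]),
    ([22222244, 22222402, 33333113, 222222, 22024222, 13111113], []),
    ([22222244, 22222402, 33333113, 11113113, 2242222, 20422222], []),
    ([22222244, 22222204, 22224422, 22442222, 44222222, 4222222], [(41, []),
      (41, [22242022, 22420222])])],
  [
    ([22222244, 22222402, 22224022, 22240222, 22402222, 44222222, 13111113], []),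
    ([22222244, 22222402, 22224022, 22240222, 22402222, 24022222, 40222222], [
      (2, [42222220, 24222242, 22244222, 22422422]),
      (3, [42222220, 24222242, 22244222, 22422422]), (3, []), (2, []), (0, []), (1, []),
      (0, [42222220, 24222242, 22244222, 22422422])]),
    ([22222244, 22222402, 22224022, 22240222, 22402222, 24022222, 222222], [(6, []),
      (0, [33311333, 31333313, 33133133]), (5, []), (0, []), (4, [])]),
    ([22222244, 22222402, 22224022, 22240222, 22402222, 24022222, 20022222], [
      (3, [44222222, 31333331, 40222222]), (3, [31111113]),
      (0, [42222224, 42222202, 42222022, 42220222, 42202222, 42022222, 40222222]), (7, []),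
      (0, [42222220, 42222242, 42222422, 42224222, 42242222, 42422222, 44222222])]),
    ([22222244, 22222402, 22224022, 22240222, 22402222, 24022222, 20222220], [(8, [])]),
    ([22222244, 22222402, 22224022, 22240222, 22402222, 24022222, 31113331], [
      (3, [31331333, 33133313, 33313133, 22244222, 22422422, 24242222, 42222202, 44222222]),
      (9, []), (5, [])]),
    ([22222244, 22222402, 22224022, 22240222, 22402222, 24022222, 31111113], []),
    ([22222244, 22222402, 22224022, 22240222, 22402222, 22002222, 44222222], [(10, [])]),
    ([22222244, 22222402, 22224022, 22240222, 22402222, 22002222, 22222240], [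
      (11, [42022222, 42422222]), (11, [])]),
    ([22222244, 22222402, 22224022, 22240222, 22402222, 22022220, 44222222], [(12, [])]),
    ([22222244, 22222402, 22224022, 22240222, 22402222, 22022220, 13111113], [
      (13, [31111113, 40222222]), (13, []), (12, [])]),
    ([22222244, 22222402, 22224022, 22240222, 22402222, 33111331, 222222], [(14, [])]),
    ([22222244, 22222402, 22224022, 22240222, 22402222, 33111331, 13111113], [
      (15, [31111113, 40222222]), (15, [])]),
    ([22222244, 22222402, 22224022, 22240222, 22402222, 13111113, 40222222], [(15, []), (16, [])]),
    ([22222244, 22222402, 22224022, 22240222, 22200222, 24422222, 40222222], [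
      (15, [44222222, 40222222, 31111113, 42022222]), (15, [22442222, 33313331, 22402222]),
      (17, []), (18, []), (17, [44222222, 24422222, 40222222])]),
    ([22222244, 22222402, 22224022, 22240222, 22200222, 24422222, 20422222], []),
    ([22222244, 22222402, 22224022, 22240222, 22200222, 22222240, 24422222], [
      (18, [42202222, 42242222]), (19, []), (18, [])]),
    ([22222244, 22222402, 22224022, 22240222, 22202220, 33311113, 222222], [
      (21, [44222222, 40222222, 31333331, 42422222]), (22, []), (20, []), (21, [])]),
    ([22222244, 22222402, 22224022, 22240222, 22202220, 33311113, 2422222], []),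
    ([22222244, 22222402, 22224022, 22240222, 33311113, 222222, 4222222], []),
    ([22222244, 22222402, 22224022, 22240222, 33311113, 222222, 24022222], [
      (17, [44222222, 40222222, 31333331, 42022222]),
      (23, [44222222, 40222222, 31333331, 42422222]),
      (17, [31313131, 33113333, 33311311, 22442222, 24222022, 42222220]), (23, [])]),
    ([22222244, 22222402, 22224022, 22220022, 22442222, 44222222, 4222222], [(24, [])]),
    ([22222244, 22222402, 22224022, 22220022, 22442222, 24022222, 40222222], [
      (17, [33331133, 33333311, 22242220, 22242422, 22420222, 22424222]),
      (17, [33331133, 33333311, 22242224, 22242022, 22420222, 22424222]), (25, []), (26, []),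
      (25, [24422222, 42202222])]),
    ([22222244, 22222402, 22224022, 22220022, 22442222, 24022222, 22222240], [
      (26, [42220222, 42224222]), (26, [40222222, 24242222, 24022222]),
      (26, [42422222, 33111111, 33113333]), (26, [31131111, 31133333]), (26, []),
      (26, [24202222, 22420222, 22424222])]),
    ([22222244, 22222402, 22224022, 22220022, 22222240, 22442222, 44222222], [(27, []),
      (27, [24202222, 42022222])]),
    ([22222244, 22222402, 22224022, 22220220, 13331113, 40222222, 44222222], [(28, [])]),
    ([22222244, 22222402, 22224022, 22220220, 13331113, 40222222, 24022222], [
      (29, [33133331, 22442222]), (31, []), (30, [33133331, 22442222]),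
      (29, [44222222, 40222222, 33131113, 42022222]), (29, []), (30, []),
      (29, [33311131, 33313313])]),
    ([22222244, 22222402, 22224022, 22220220, 13331113, 40222222, 22002222], [(33, []),
      (30, [40222222, 33133331, 24242222]), (32, [24202222, 42422222]), (32, [])]),
    ([22222244, 22222402, 22224022, 22220220, 13331113, 40222222, 13113331], [
      (34, [33311131, 33313313]), (34, [])]),
    ([22222244, 22222402, 22224022, 22220220, 13331113, 42242222, 20422222], [(35, [])]),
    ([22222244, 22222402, 22224022, 13331113, 40222222, 44222222, 22042222], []),
    ([22222244, 22222402, 22224022, 13331113, 40222222, 22002222, 44222222], [(36, [])]),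
    ([22222244, 22222402, 22224022, 13331113, 42242222, 20422222, 31111113], []),
    ([22222244, 22222402, 22222020, 33333113, 222222, 24022222, 40222222], [
      (22, [31113331, 31313113, 33111313, 33333311, 22422224]),
      (39, [24222022, 33133331, 31111131, 33111313]),
      (37, [24222022, 33133331, 31111131, 33111313]), (39, []), (38, []), (37, [])]),
    ([22222244, 22222402, 22222020, 33333113, 222222, 24022222, 42202222], [
      (37, [44222222, 40222222, 31311331, 42422222]),
      (37, [31111113, 31113331, 22244222, 42022222, 40222222, 44222222]),
      (37, [44222222, 42422222, 31131331, 42242222]),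
      (37, [24202222, 22244222, 33111331, 33131113]), (40, []),
      (37, [31131331, 22402222, 24220222, 24224222, 24422222, 44222222]),
      (37, [42022222, 24224222, 33111331, 24220222])]),
    ([22222244, 22222402, 22222020, 33333113, 222222, 24022222, 22204222], [(41, [])]),
    ([22222244, 22222402, 22222020, 33333113, 222222, 22024222, 22402222], [(42, [])]),
    ([22222244, 22222402, 22222020, 33333113, 222222, 22024222, 13111113], []),
    ([22222244, 22222402, 22222020, 33333113, 222222, 33111331, 22024222], [(44, []),
      (43, [22240222, 22402222]), (43, [])]),
    ([22222244, 22222402, 22222020, 33333113, 11113113, 2242222, 20422222], []),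
    ([22222244, 22222402, 33333113, 222222, 22024222, 22402222, 13111113], [
      (45, [31111113, 40222222]), (45, [])]),
    ([22222244, 22222204, 22224422, 22442222, 44222222, 4222222, 22042222], [(46, [])])],
  [
    ([22222244, 22222402, 22224022, 22240222, 22402222, 24022222, 40222222, 222222], []),
    ([22222244, 22222402, 22224022, 22240222, 22402222, 24022222, 40222222, 2222220], []),
    ([22222244, 22222402, 22224022, 22240222, 22402222, 24022222, 40222222, 13333331], []),
    ([22222244, 22222402, 22224022, 22240222, 22402222, 24022222, 40222222, 11133331], []),
    ([22222244, 22222402, 22224022, 22240222, 22402222, 24022222, 222222, 42222220], []),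
    ([22222244, 22222402, 22224022, 22240222, 22402222, 24022222, 222222, 31113331], []),
    ([22222244, 22222402, 22224022, 22240222, 22402222, 24022222, 222222, 31111113], []),
    ([22222244, 22222402, 22224022, 22240222, 22402222, 24022222, 20022222, 22222240], []),
    ([22222244, 22222402, 22224022, 22240222, 22402222, 24022222, 20222220, 31111113], []),
    ([22222244, 22222402, 22224022, 22240222, 22402222, 24022222, 31113331, 31111113], []),
    ([22222244, 22222402, 22224022, 22240222, 22402222, 22002222, 44222222, 4222222], []),
    ([22222244, 22222402, 22224022, 22240222, 22402222, 22002222, 22222240, 44222222], []),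
    ([22222244, 22222402, 22224022, 22240222, 22402222, 22022220, 44222222, 13111113], []),
    ([22222244, 22222402, 22224022, 22240222, 22402222, 22022220, 13111113, 40222222], []),
    ([22222244, 22222402, 22224022, 22240222, 22402222, 33111331, 222222, 13111113], []),
    ([22222244, 22222402, 22224022, 22240222, 22402222, 33111331, 13111113, 40222222], []),
    ([22222244, 22222402, 22224022, 22240222, 22402222, 13111113, 40222222, 44222222], []),
    ([22222244, 22222402, 22224022, 22240222, 22200222, 24422222, 40222222, 222222], []),
    ([22222244, 22222402, 22224022, 22240222, 22200222, 24422222, 40222222, 22222240], []),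
    ([22222244, 22222402, 22224022, 22240222, 22200222, 22222240, 24422222, 20422222], []),
    ([22222244, 22222402, 22224022, 22240222, 22202220, 33311113, 222222, 4222222], []),
    ([22222244, 22222402, 22224022, 22240222, 22202220, 33311113, 222222, 24022222], []),
    ([22222244, 22222402, 22224022, 22240222, 22202220, 33311113, 222222, 33133331], []),
    ([22222244, 22222402, 22224022, 22240222, 33311113, 222222, 24022222, 40222222], []),
    ([22222244, 22222402, 22224022, 22220022, 22442222, 44222222, 4222222, 22042222], []),
    ([22222244, 22222402, 22224022, 22220022, 22442222, 24022222, 40222222, 222222], []),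
    ([22222244, 22222402, 22224022, 22220022, 22442222, 24022222, 40222222, 22222240], []),
    ([22222244, 22222402, 22224022, 22220022, 22222240, 22442222, 44222222, 4222222], []),
    ([22222244, 22222402, 22224022, 22220220, 13331113, 40222222, 44222222, 22042222], []),
    ([22222244, 22222402, 22224022, 22220220, 13331113, 40222222, 24022222, 222222], []),
    ([22222244, 22222402, 22224022, 22220220, 13331113, 40222222, 24022222, 2202222], []),
    ([22222244, 22222402, 22224022, 22220220, 13331113, 40222222, 24022222, 11313331], []),
    ([22222244, 22222402, 22224022, 22220220, 13331113, 40222222, 22002222, 44222222], []),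
    ([22222244, 22222402, 22224022, 22220220, 13331113, 40222222, 22002222, 13333331], []),
    ([22222244, 22222402, 22224022, 22220220, 13331113, 40222222, 13113331, 44222222], []),
    ([22222244, 22222402, 22224022, 22220220, 13331113, 42242222, 20422222, 31111113], []),
    ([22222244, 22222402, 22224022, 13331113, 40222222, 22002222, 44222222, 22042222], []),
    ([22222244, 22222402, 22222020, 33333113, 222222, 24022222, 40222222, 22402222], []),
    ([22222244, 22222402, 22222020, 33333113, 222222, 24022222, 40222222, 22204222], []),
    ([22222244, 22222402, 22222020, 33333113, 222222, 24022222, 40222222, 22200222], []),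
    ([22222244, 22222402, 22222020, 33333113, 222222, 24022222, 42202222, 33331331], []),
    ([22222244, 22222402, 22222020, 33333113, 222222, 24022222, 22204222, 31111113], []),
    ([22222244, 22222402, 22222020, 33333113, 222222, 22024222, 22402222, 13111113], []),
    ([22222244, 22222402, 22222020, 33333113, 222222, 33111331, 22024222, 22402222], []),
    ([22222244, 22222402, 22222020, 33333113, 222222, 33111331, 22024222, 13111113], []),
    ([22222244, 22222402, 33333113, 222222, 22024222, 22402222, 13111113, 40222222], []),
    ([22222244, 22222204, 22224422, 22442222, 44222222, 4222222, 22042222, 22220422], [])]]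


/-- The representatives of cliques of size `k` with their certificates. -/
def cliqueData (k : ℕ) : List (List Vec × List (ℕ × List Vec)) :=
  (cliqueTable.getD k []).map fun p =>
    (p.1.map ofCode, p.2.map fun c => (c.1, c.2.map ofCode))

/-- The representatives of cliques of size `k`. -/
def cliqueReps (k : ℕ) : List (List Vec) := (cliqueData k).map Prod.fst

/-- Four times the frame operator of `T`. -/
def frame (T : List Vec) (v : Vec) : Vec :=
  T.foldr (fun t u => u.addMul (v.dot t) t) ⟨0, 0, 0, 0, 0, 0, 0, 0⟩

/-- Two integers depending only on the orbit of `T`. -/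
def invariants (T : List Vec) : ℤ × ℤ :=
  ((T.map fun s => (frame T (frame T s)).dot (frame T (frame T s))).prod,
    (rootList.map fun r => (T.map fun s => r.dot s + 4).prod).sum)

theorem allLinked_cliqueData : ∀ k < 8, ∀ p ∈ cliqueData k,
    allLinked k (cliqueReps (k + 1)) p.1 (rootList.filter (isExtension p.1)) p.2 = true := by
  decide +kernel

theorem nodup_cliqueReps : ∀ k ≤ 8, ∀ T ∈ cliqueReps k, T.Nodup := by
  decide +kernel

theorem length_cliqueReps : (cliqueReps 8).length = 47 := by
  decide +kernel

theorem clique_of_mem_cliqueReps : ∀ T ∈ cliqueReps 8, T.length = 8 ∧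
    (∀ r ∈ T, r.isRoot = true) ∧ ∀ r ∈ T, ∀ s ∈ T, r ≠ s → r.dot s = 0 ∨ r.dot s = -4 := by
  decide +kernel

theorem nodup_invariants : ((cliqueReps 8).map invariants).Nodup := by
  decide +kernel

/-- A number whose values strictly increase along `rootList`. -/
def lexKey (v : Vec) : ℤ :=
  v.x7 + 10 * (v.x6 + 10 * (v.x5 + 10 * (v.x4 + 10 * (v.x3 + 10 * (v.x2 + 10 * (v.x1 + 10 *
    (v.x0 - 10 * (v.x0 % 2))))))))

theorem nodup_rootList : rootList.Nodup := by
  have h : (rootList.map lexKey).IsChain (· < ·) := by decide +kernel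
  exact List.Nodup.of_map lexKey ((List.isChain_iff_pairwise.1 h).imp ne_of_lt)

section Lattice

theorem E8dot_eq_dotProduct (v w : Fin 8 → ℚ) : E8dot v w = v ⬝ᵥ w := rfl

theorem E8dot_comm (v w : Fin 8 → ℚ) : E8dot v w = E8dot w v := dotProduct_comm v w

theorem E8dot_add_smul (u v w : Fin 8 → ℚ) (c : ℚ) :
    E8dot u (v + c • w) = E8dot u v + c * E8dot u w := by
  simp [E8dot_eq_dotProduct, dotProduct_add]

theorem E8dot_sum_right (v : Fin 8 → ℚ) (S : Finset (Fin 8 → ℚ)) :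
    E8dot v (∑ s ∈ S, s) = ∑ s ∈ S, E8dot v s :=
  dotProduct_sum v S _

/-- The dot product of two vectors of the E8 lattice is an integer. -/
theorem exists_int_E8dot {v w : Fin 8 → ℚ} (hv : InE8 v) (hw : InE8 w) :
    ∃ n : ℤ, E8dot v w = n := by
  obtain ⟨hv, a, ha⟩ := hv
  obtain ⟨hw, b, hb⟩ := hw
  rcases hv with hv | hv <;> rcases hw with hw | hw <;> choose m hm using hv <;>
    choose n hn using hw
  · refine ⟨∑ i, m i * n i, ?_⟩
    simp [E8dot, hm, hn]
  · refine ⟨∑ i, m i * n i + a, ?_⟩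
    have hn' : ∀ i, w i = n i + 1 / 2 := fun i => by linarith [hn i]
    simp only [E8dot, hm, hn', mul_add, Finset.sum_add_distrib, ← Finset.sum_mul] at ha ⊢
    rw [ha]
    push_cast
    ring
  · refine ⟨∑ i, m i * n i + b, ?_⟩
    have hm' : ∀ i, v i = m i + 1 / 2 := fun i => by linarith [hm i]
    simp only [E8dot, hm', hn, add_mul, Finset.sum_add_distrib, ← Finset.mul_sum] at hb ⊢
    rw [hb]
    push_cast
    ring
  · refine ⟨∑ i, m i * n i + a + b - 2, ?_⟩
    have hm' : ∀ i, v i = m i + 1 / 2 := fun i => by linarith [hm i]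
    have hn' : ∀ i, w i = n i + 1 / 2 := fun i => by linarith [hn i]
    simp only [E8dot, hm', hn', Fin.sum_univ_eight] at ha hb ⊢
    push_cast [Fin.sum_univ_eight]
    linear_combination (1 / 2) * ha + (1 / 2) * hb

theorem _root_.InE8.add_zsmul {v w : Fin 8 → ℚ} (hv : InE8 v) (hw : InE8 w) (k : ℤ) :
    InE8 (v + (k : ℚ) • w) := by
  obtain ⟨hv, a, ha⟩ := hv
  obtain ⟨hw, b, hb⟩ := hw
  refine ⟨?_, a + k * b, ?_⟩
  · rcases hw with hw | hw <;> choose n hn using hw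
    · refine hv.imp (fun h i => ?_) fun h i => ?_ <;>
      · obtain ⟨m, hm⟩ := h i
        refine ⟨m + k * n i, ?_⟩
        push_cast
        rw [← hm]
        simp [hn]
        try ring
    · have hn' : ∀ i, w i = n i + 1 / 2 := fun i => by linarith [hn i]
      obtain ⟨c, rfl | rfl⟩ := k.even_or_odd'
      · refine hv.imp (fun h i => ?_) fun h i => ?_ <;>
        · obtain ⟨m, hm⟩ := h i
          refine ⟨m + 2 * c * n i + c, ?_⟩
          push_cast
          rw [← hm]
          simp [hn']
          ring
      · refine hv.symm.imp (fun h i => ?_) fun h i => ?_ <;> obtain ⟨m, hm⟩ := h i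
        · refine ⟨m + 2 * c * n i + c + n i + 1, ?_⟩
          push_cast
          rw [← hm]
          simp [hn']
          ring
        · refine ⟨m + 2 * c * n i + c + n i, ?_⟩
          push_cast
          rw [← hm]
          simp [hn']
          ring
  · simp only [Pi.add_apply, Pi.smul_apply, smul_eq_mul, Finset.sum_add_distrib,
      ← Finset.mul_sum, ha, hb]
    push_cast
    ring

end Lattice

section WeylGroup

theorem _root_.InW.refl : InW (LinearEquiv.refl ℚ (Fin 8 → ℚ)) :=
  ⟨fun _ _ => rfl, Set.image_id _⟩

variable {g h : (Fin 8 → ℚ) ≃ₗ[ℚ] (Fin 8 → ℚ)}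

theorem _root_.InW.trans (hg : InW g) (hh : InW h) : InW (g.trans h) := by
  refine ⟨fun v w => by simp [hg.1, hh.1], ?_⟩
  calc ⇑(g.trans h) '' {v | InE8 v} = ⇑h '' (⇑g '' {v | InE8 v}) :=
        (Set.image_image ⇑h ⇑g _).symm
    _ = {v | InE8 v} := by rw [hg.2, hh.2]

theorem _root_.InW.symm (hg : InW g) : InW g.symm := by
  refine ⟨fun v w => by simpa using (hg.1 (g.symm v) (g.symm w)).symm, ?_⟩
  conv_lhs => rw [← hg.2]
  simp [← Set.image_comp]

theorem _root_.InW.inE8_iff (hg : InW g) {v : Fin 8 → ℚ} : InE8 (g v) ↔ InE8 v := by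
  have h : g v ∈ ⇑g '' {v | InE8 v} ↔ v ∈ {v | InE8 v} := g.injective.mem_set_image
  rwa [hg.2] at h

theorem _root_.InW.isE8Root_iff (hg : InW g) {v : Fin 8 → ℚ} : IsE8Root (g v) ↔ IsE8Root v := by
  rw [IsE8Root, IsE8Root, hg.inE8_iff, hg.1]

/-- The reflection in a vector of squared length two. -/
def reflection (r : Fin 8 → ℚ) (hr : E8dot r r = 2) : (Fin 8 → ℚ) ≃ₗ[ℚ] (Fin 8 → ℚ) :=
  LinearEquiv.ofInvolutive
    { toFun := fun v => v + (-E8dot r v) • r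
      map_add' := fun v w => by
        simp only [E8dot_eq_dotProduct, dotProduct_add]
        module
      map_smul' := fun c v => by
        simp only [E8dot_eq_dotProduct, dotProduct_smul, RingHom.id_apply, smul_eq_mul]
        module }
    fun v => by
      simp only [LinearMap.coe_mk, AddHom.coe_mk, E8dot_add_smul, hr]
      module

theorem reflection_apply (r : Fin 8 → ℚ) (hr : E8dot r r = 2) (v : Fin 8 → ℚ) :
    reflection r hr v = v + (-E8dot r v) • r := rfl

theorem inW_reflection {r : Fin 8 → ℚ} (hr : IsE8Root r) : InW (reflection r hr.2) := by
  have key : ∀ v, InE8 v → InE8 (reflection r hr.2 v) := fun v hv => by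
    obtain ⟨n, hn⟩ := exists_int_E8dot hr.1 hv
    have := hv.add_zsmul hr.1 (-n)
    rwa [Int.cast_neg, ← hn] at this
  refine ⟨fun v w => ?_, Set.Subset.antisymm ?_ fun v hv => ?_⟩
  · rw [reflection_apply, reflection_apply, E8dot_add_smul, E8dot_comm _ w, E8dot_comm _ r,
      E8dot_add_smul, E8dot_add_smul, hr.2, E8dot_comm w v, E8dot_comm w r]
    ring
  · rintro _ ⟨v, hv, rfl⟩
    exact key v hv
  · exact ⟨_, key v hv, (reflection r hr.2).left_inv v⟩

end WeylGroup

section Representation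

open Vec

theorem E8dot_toRat (v w : Vec) : E8dot v.toRat w.toRat = v.dot w / 4 := by
  simp only [E8dot, toRat, dot, Fin.sum_univ_eight]
  simp
  ring

theorem dot_cast (v w : Vec) : (v.dot w : ℚ) = 4 * E8dot v.toRat w.toRat := by
  rw [E8dot_toRat]
  ring

theorem toRat_addMul (v : Vec) (k : ℤ) (w : Vec) :
    (v.addMul k w).toRat = v.toRat + (k : ℚ) • w.toRat := by
  ext i
  fin_cases i <;> simp [toRat, addMul] <;> ring

theorem toRat_injective : Function.Injective toRat := fun v w h => by
  have h' : ∀ i, v.toRat i = w.toRat i := fun i => by rw [h]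
  simp [toRat, Fin.forall_fin_succ] at h'
  ext <;> tauto

theorem hasParity_iff (e : ℤ) (v : Vec) : hasParity e v = true ↔
    v.x0 % 2 = e ∧ v.x1 % 2 = e ∧ v.x2 % 2 = e ∧ v.x3 % 2 = e ∧ v.x4 % 2 = e ∧ v.x5 % 2 = e ∧
      v.x6 % 2 = e ∧ v.x7 % 2 = e := by
  simp [hasParity, and_assoc]

theorem exists_half_eq (x : ℤ) : (∃ n : ℤ, (x : ℚ) / 2 = n) ↔ x % 2 = 0 := by
  constructor
  · rintro ⟨n, hn⟩
    have : (x : ℚ) = (2 * n : ℤ) := by push_cast; linarith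
    have := Int.cast_injective this
    omega
  · intro h
    refine ⟨x / 2, ?_⟩
    have : (x : ℚ) = (2 * (x / 2) : ℤ) := congrArg _ (by omega)
    push_cast at this ⊢
    linarith

theorem exists_half_sub_half_eq (x : ℤ) : (∃ n : ℤ, (x : ℚ) / 2 - 1 / 2 = n) ↔ x % 2 = 1 := by
  have h := exists_half_eq (x - 1)
  push_cast at h
  rw [show (x : ℚ) / 2 - 1 / 2 = (x - 1) / 2 by ring, h]
  omega

theorem isE8Root_toRat (v : Vec) : IsE8Root v.toRat ↔ v.isRoot = true := by
  have h1 : (∃ n : ℤ, ∑ i, v.toRat i = 2 * n) ↔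
      (v.x0 + v.x1 + v.x2 + v.x3 + v.x4 + v.x5 + v.x6 + v.x7) % 4 = 0 := by
    have : ∑ i, v.toRat i =
        (v.x0 + v.x1 + v.x2 + v.x3 + v.x4 + v.x5 + v.x6 + v.x7 : ℤ) / (2 : ℚ) := by
      simp [toRat, Fin.sum_univ_eight]
      ring
    rw [this]
    generalize v.x0 + v.x1 + v.x2 + v.x3 + v.x4 + v.x5 + v.x6 + v.x7 = x
    constructor
    · rintro ⟨n, hn⟩
      have : (x : ℚ) = (4 * n : ℤ) := by push_cast; linarith
      have := Int.cast_injective this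
      omega
    · intro h
      refine ⟨x / 4, ?_⟩
      have : (x : ℚ) = (4 * (x / 4) : ℤ) := congrArg _ (by omega)
      push_cast at this ⊢
      linarith
  have h2 : E8dot v.toRat v.toRat = 2 ↔ v.dot v = 8 := by
    rw [E8dot_toRat, div_eq_iff (by norm_num)]
    norm_cast
  have h3 : (∀ i, ∃ n : ℤ, v.toRat i = n) ↔ hasParity 0 v = true := by
    simp only [hasParity_iff, ← exists_half_eq]
    simp [toRat, Fin.forall_fin_succ]
  have h4 : (∀ i, ∃ n : ℤ, v.toRat i - 1 / 2 = n) ↔ hasParity 1 v = true := by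
    simp only [hasParity_iff, ← exists_half_sub_half_eq]
    simp [toRat, Fin.forall_fin_succ]
  rw [IsE8Root, InE8, h1, h2, h3, h4]
  simp [isRoot]
  tauto

theorem mem_quadruples {l : List ℤ} {a b c d : ℤ} : (a, b, c, d) ∈ quadruples l ↔
    (a ∈ l ∧ b ∈ l ∧ c ∈ l ∧ d ∈ l) ∧ a * a + b * b + c * c + d * d ≤ 8 := by
  simp [quadruples]

theorem mem_box {l : List ℤ} {v : Vec} (hv : v.dot v = 8) (h : v.x0 ∈ l ∧ v.x1 ∈ l ∧ v.x2 ∈ l ∧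
    v.x3 ∈ l ∧ v.x4 ∈ l ∧ v.x5 ∈ l ∧ v.x6 ∈ l ∧ v.x7 ∈ l) : v ∈ box l := by
  simp only [dot] at hv
  simp only [box, List.mem_flatMap, List.mem_map]
  refine ⟨(v.x0, v.x1, v.x2, v.x3), mem_quadruples.2 ⟨by tauto, ?_⟩,
    (v.x4, v.x5, v.x6, v.x7), mem_quadruples.2 ⟨by tauto, ?_⟩, rfl⟩
  · linarith [mul_self_nonneg v.x4, mul_self_nonneg v.x5, mul_self_nonneg v.x6,
      mul_self_nonneg v.x7]
  · linarith [mul_self_nonneg v.x0, mul_self_nonneg v.x1, mul_self_nonneg v.x2,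
      mul_self_nonneg v.x3]

theorem mem_rootList {v : Vec} : v ∈ rootList ↔ v.isRoot = true := by
  refine ⟨fun h => (List.mem_filter.1 h).2, fun h => List.mem_filter.2 ⟨?_, h⟩⟩
  simp only [isRoot, Bool.and_eq_true, Bool.or_eq_true, beq_iff_eq, hasParity_iff] at h
  obtain ⟨⟨hv, -⟩, h⟩ := h
  have hv' := hv
  simp only [dot] at hv'
  have bound : ∀ x : ℤ, x * x ≤ 8 → -2 ≤ x ∧ x ≤ 2 := fun x hx =>
    ⟨by nlinarith, by nlinarith⟩
  have := mul_self_nonneg v.x0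
  have := mul_self_nonneg v.x1
  have := mul_self_nonneg v.x2
  have := mul_self_nonneg v.x3
  have := mul_self_nonneg v.x4
  have := mul_self_nonneg v.x5
  have := mul_self_nonneg v.x6
  have := mul_self_nonneg v.x7
  have := bound v.x0 (by linarith)
  have := bound v.x1 (by linarith)
  have := bound v.x2 (by linarith)
  have := bound v.x3 (by linarith)
  have := bound v.x4 (by linarith)
  have := bound v.x5 (by linarith)
  have := bound v.x6 (by linarith)
  have := bound v.x7 (by linarith)
  rw [List.mem_append]
  refine h.symm.imp (fun h => mem_box hv ?_) fun h => mem_box hv ?_ <;>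
  · simp only [List.mem_cons, List.not_mem_nil, or_false]
    refine ⟨?_, ?_, ?_, ?_, ?_, ?_, ?_, ?_⟩ <;> omega

theorem exists_toRat_eq {v : Fin 8 → ℚ} (hv : IsE8Root v) : ∃ x ∈ rootList, x.toRat = v := by
  suffices h : ∃ x : Vec, x.toRat = v by
    obtain ⟨x, rfl⟩ := h
    exact ⟨x, mem_rootList.2 ((isE8Root_toRat x).1 hv), rfl⟩
  have h : ∀ i, ∃ n : ℤ, v i = n / 2 := fun i => by
    rcases hv.1.1 with h | h <;> obtain ⟨n, hn⟩ := h i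
    · exact ⟨2 * n, by rw [hn]; push_cast; ring⟩
    · exact ⟨2 * n + 1, by rw [sub_eq_iff_eq_add.1 hn]; push_cast; ring⟩
  choose n hn using h
  refine ⟨⟨n 0, n 1, n 2, n 3, n 4, n 5, n 6, n 7⟩, ?_⟩
  ext i
  rw [hn]
  fin_cases i <;> rfl

theorem isE8Root_of_mem {x : Vec} (hx : x ∈ rootList) : IsE8Root x.toRat :=
  (isE8Root_toRat x).2 (mem_rootList.1 hx)

theorem toRat_reflect {r v : Vec} (hr : IsE8Root r.toRat) (hv : IsE8Root v.toRat) :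
    (reflect r v).toRat = reflection r.toRat hr.2 v.toRat := by
  obtain ⟨n, hn⟩ := exists_int_E8dot hr.1 hv.1
  have h : r.dot v = 4 * n := by
    have := dot_cast r v
    rw [hn] at this
    exact_mod_cast this
  rw [reflect, toRat_addMul, reflection_apply, hn, h]
  simp

theorem exists_inW_reflectAll {w : List Vec} (hw : ∀ r ∈ w, r.isRoot = true) :
    ∃ g, InW g ∧ ∀ v : Vec, IsE8Root v.toRat → (reflectAll w v).toRat = g v.toRat := by
  induction w with
  | nil => exact ⟨_, InW.refl, fun _ _ => rfl⟩
  | cons r w ih =>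
    obtain ⟨g, hg, h⟩ := ih fun x hx => hw x (List.mem_cons_of_mem _ hx)
    have hr := (isE8Root_toRat r).2 (hw r List.mem_cons_self)
    refine ⟨_, (inW_reflection hr).trans hg, fun v hv => ?_⟩
    have hv' := toRat_reflect hr hv
    rw [LinearEquiv.trans_apply, ← hv']
    exact h _ (hv' ▸ (inW_reflection hr).isE8Root_iff.2 hv)

/-- The set of rational vectors represented by a list. -/
def ratFinset (T : List Vec) : Finset (Fin 8 → ℚ) := (T.map toRat).toFinset

theorem mem_ratFinset {T : List Vec} {v : Fin 8 → ℚ} :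
    v ∈ ratFinset T ↔ ∃ x ∈ T, x.toRat = v := by
  simp [ratFinset]

theorem mem_ratFinset_rootList {v : Fin 8 → ℚ} : v ∈ ratFinset rootList ↔ IsE8Root v :=
  mem_ratFinset.trans ⟨fun ⟨_, hx, h⟩ => h ▸ isE8Root_of_mem hx, exists_toRat_eq⟩

end Representation

section Orbits

open Vec

/-- The sets `S` and `T` lie in the same orbit of the Weyl group. -/
def SameOrbit (S T : Finset (Fin 8 → ℚ)) : Prop :=
  ∃ g : (Fin 8 → ℚ) ≃ₗ[ℚ] (Fin 8 → ℚ), InW g ∧ S.image ⇑g = T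

theorem SameOrbit.trans {S T U : Finset (Fin 8 → ℚ)} (h₁ : SameOrbit S T)
    (h₂ : SameOrbit T U) : SameOrbit S U := by
  obtain ⟨g, hg, rfl⟩ := h₁
  obtain ⟨h, hh, rfl⟩ := h₂
  exact ⟨g.trans h, hg.trans hh, by rw [Finset.image_image]; rfl⟩

/-- A set of roots with pairwise dot products `0` or `-1`. -/
def IsClique (S : Finset (Fin 8 → ℚ)) : Prop :=
  (∀ r ∈ S, IsE8Root r) ∧ ∀ r ∈ S, ∀ s ∈ S, r ≠ s → (E8dot r s = 0 ∨ E8dot r s = -1)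

theorem IsClique.image {S : Finset (Fin 8 → ℚ)} (hS : IsClique S)
    {g : (Fin 8 → ℚ) ≃ₗ[ℚ] (Fin 8 → ℚ)} (hg : InW g) : IsClique (S.image ⇑g) := by
  simp only [IsClique, Finset.forall_mem_image, hg.isE8Root_iff, hg.1]
  exact ⟨hS.1, fun r hr s hs h => hS.2 r hr s hs fun h' => h (h' ▸ rfl)⟩

/-- Any root can be made dominant for the simple roots orthogonal to `T` by an element of the Weyl
group fixing `T` pointwise. -/
theorem exists_dominant (T : List Vec) {v : Fin 8 → ℚ} (hv : IsE8Root v) :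
    ∃ g, InW g ∧ (∀ t ∈ T, g t.toRat = t.toRat) ∧
      ∀ a ∈ simpleRoots, (∀ t ∈ T, a.dot t = 0) → 0 ≤ E8dot a.toRat (g v) := by
  classical
  let X := (ratFinset rootList).filter fun x =>
    ∃ g, InW g ∧ (∀ t ∈ T, g t.toRat = t.toRat) ∧ g v = x
  obtain ⟨_, hx, hmax⟩ := X.exists_max_image (E8dot weylVector.toRat) ⟨v, Finset.mem_filter.2
    ⟨mem_ratFinset_rootList.2 hv, _, InW.refl, fun _ _ => rfl, rfl⟩⟩
  obtain ⟨hx, g, hg, hT, rfl⟩ := Finset.mem_filter.1 hx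
  refine ⟨g, hg, hT, fun a ha hortho => ?_⟩
  have simple : ∀ a ∈ simpleRoots, a.isRoot = true ∧ 0 < weylVector.dot a := by decide +kernel
  have har := (isE8Root_toRat a).2 (simple a ha).1
  have hpos : 0 < E8dot weylVector.toRat a.toRat := by
    rw [E8dot_toRat]
    exact div_pos (Int.cast_pos.2 (simple a ha).2) (by norm_num)
  have hmem : reflection a.toRat har.2 (g v) ∈ X := by
    refine Finset.mem_filter.2 ⟨mem_ratFinset_rootList.2 ?_, _, hg.trans (inW_reflection har),
      fun t ht => ?_, rfl⟩
    · rwa [(inW_reflection har).isE8Root_iff, hg.isE8Root_iff]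
    · rw [LinearEquiv.trans_apply, hT t ht, reflection_apply, E8dot_toRat, hortho t ht]
      simp
  have h := hmax _ hmem
  rw [reflection_apply, E8dot_add_smul] at h
  by_contra! hneg
  nlinarith

theorem exists_isLink {k : ℕ} {L : List (List Vec)} {T : List Vec} :
    ∀ {R : List Vec} {C : List (ℕ × List Vec)}, allLinked k L T R C = true →
      ∀ r ∈ R, ∃ c, isLink k L T r c = true
  | [], _, _ => by simp
  | r :: R, [], h => by simp [allLinked] at h
  | r :: R, c :: C, h => by
    rw [allLinked, Bool.and_eq_true] at h
    rintro x (_ | ⟨_, hx⟩)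
    · exact ⟨c, h.1⟩
    · exact exists_isLink h.2 x hx

theorem sameOrbit_of_isLink {k : ℕ} {L : List (List Vec)} {T : List Vec} {r : Vec}
    {c : ℕ × List Vec} (h : isLink k L T r c = true) (hr : ∀ x ∈ r :: T, IsE8Root x.toRat)
    (hk : (ratFinset (r :: T)).card = k + 1) :
    ∃ T' ∈ L, SameOrbit (ratFinset (r :: T)) (ratFinset T') := by
  unfold isLink at h
  split at h
  · exact absurd h Bool.false_ne_true
  next T' hT' =>
    simp only [Bool.and_eq_true, List.all_eq_true, decide_eq_true_eq] at h
    obtain ⟨⟨hw, hlen⟩, h⟩ := h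
    obtain ⟨g, hg, hgv⟩ := exists_inW_reflectAll hw
    refine ⟨T', List.mem_of_getElem? hT', g, hg, Finset.eq_of_subset_of_card_le ?_ ?_⟩
    · intro y hy
      obtain ⟨_, hz, rfl⟩ := Finset.mem_image.1 hy
      obtain ⟨x, hx, rfl⟩ := mem_ratFinset.1 hz
      exact mem_ratFinset.2 ⟨_, h x hx, hgv x (hr x hx)⟩
    · rw [Finset.card_image_of_injective _ g.injective, hk]
      exact ((List.toFinset_card_le _).trans_eq (List.length_map _)).trans hlen

theorem sum_dot_cast (T : List Vec) (hT : (T.map toRat).Nodup) (v : Vec) :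
    ((T.map v.dot).sum : ℚ) = 4 * E8dot v.toRat (∑ s ∈ ratFinset T, s) := by
  rw [E8dot_sum_right, ratFinset, List.sum_toFinset _ hT, Int.cast_list_sum, List.map_map,
    List.map_map, ← List.sum_map_mul_left]
  simp only [Function.comp_def, dot_cast]

theorem isExtension_of_isClique {T : List Vec} {r : Vec} (hnodup : ((r :: T).map toRat).Nodup)
    (hS : IsClique (ratFinset (r :: T)))
    (hmax : ∀ s ∈ ratFinset (r :: T), E8dot s (∑ x ∈ ratFinset (r :: T), x) ≤
      E8dot r.toRat (∑ x ∈ ratFinset (r :: T), x))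
    (hdom : ∀ a ∈ simpleRoots, (∀ t ∈ T, a.dot t = 0) → 0 ≤ E8dot a.toRat r.toRat) :
    isExtension T r = true := by
  simp only [isExtension, Bool.and_eq_true, List.all_eq_true, Bool.or_eq_true, beq_iff_eq,
    decide_eq_true_eq, List.any_eq_true, bne_iff_ne]
  have mem : ∀ t ∈ r :: T, t.toRat ∈ ratFinset (r :: T) := fun t ht =>
    mem_ratFinset.2 ⟨t, ht, rfl⟩
  refine ⟨⟨fun t ht => ?_, fun a ha => ?_⟩, fun t ht => ?_⟩
  · have hne : t.toRat ≠ r.toRat := fun h =>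
      (List.nodup_cons.1 hnodup).1 (h ▸ List.mem_map_of_mem ht)
    have h := hS.2 _ (mem t (List.mem_cons_of_mem _ ht)) _ (mem r List.mem_cons_self) hne
    refine h.imp (fun h => ?_) fun h => ?_ <;>
    · have := dot_cast t r
      rw [h] at this
      norm_num at this
      exact_mod_cast this
  · by_cases h : ∀ t ∈ T, a.dot t = 0
    · left
      have := hdom a ha h
      rw [E8dot_toRat] at this
      have h' : (0 : ℚ) ≤ a.dot r := by linarith
      exact_mod_cast h'
    · right
      push Not at h
      exact h
  · have h := hmax _ (mem t (List.mem_cons_of_mem _ ht))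
    have h' : (((r :: T).map t.dot).sum : ℚ) ≤ ((r :: T).map r.dot).sum := by
      rw [sum_dot_cast _ hnodup, sum_dot_cast _ hnodup]
      linarith
    exact_mod_cast h'

theorem IsClique.mono {S T : Finset (Fin 8 → ℚ)} (hT : IsClique T) (h : S ⊆ T) : IsClique S :=
  ⟨fun r hr => hT.1 r (h hr), fun r hr s hs => hT.2 r (h hr) s (h hs)⟩

theorem sum_image_apply {g : (Fin 8 → ℚ) ≃ₗ[ℚ] (Fin 8 → ℚ)} (S : Finset (Fin 8 → ℚ)) :
    ∑ x ∈ S.image ⇑g, x = g (∑ x ∈ S, x) := by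
  rw [Finset.sum_image g.injective.injOn, map_sum]

theorem ratFinset_cons (r : Vec) (T : List Vec) :
    ratFinset (r :: T) = insert r.toRat (ratFinset T) := by
  simp [ratFinset]

theorem card_ratFinset {T : List Vec} (hT : T.Nodup) : (ratFinset T).card = T.length := by
  rw [ratFinset, List.toFinset_card_of_nodup (hT.map toRat_injective), List.length_map]

/-- Every clique with at most eight elements is equivalent to a listed representative. -/
theorem exists_rep : ∀ k ≤ 8, ∀ S, IsClique S → S.card = k →
    ∃ T ∈ cliqueReps k, SameOrbit S (ratFinset T) := by
  intro k
  induction k with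
  | zero =>
    intro _ S _ hS
    rw [Finset.card_eq_zero] at hS
    subst hS
    exact ⟨[], by decide +kernel, _, InW.refl, rfl⟩
  | succ k ih =>
    intro hk S hS hcard
    obtain ⟨r, hr, hmax⟩ := S.exists_max_image (fun r => E8dot r (∑ s ∈ S, s))
      (Finset.card_pos.1 (by omega))
    obtain ⟨T, hT, g, hg, hgT⟩ := ih (by omega) (S.erase r) (hS.mono (S.erase_subset r))
      (by rw [Finset.card_erase_of_mem hr, hcard, Nat.add_sub_cancel])
    obtain ⟨h, hh, hfix, hdom⟩ := exists_dominant T (hg.isE8Root_iff.2 (hS.1 r hr))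
    obtain ⟨y, hy, hyr⟩ := exists_toRat_eq
      (hh.isE8Root_iff.2 (hg.isE8Root_iff.2 (hS.1 r hr)))
    set f := g.trans h with hf
    have hfW : InW f := hg.trans hh
    have hfr : f r = y.toRat := hyr.symm
    have hferase : (S.erase r).image ⇑f = ratFinset T := by
      have : (S.erase r).image ⇑f = ((S.erase r).image ⇑g).image ⇑h := by
        rw [Finset.image_image]
        rfl
      rw [this, hgT]
      refine (Finset.image_congr fun x hx => ?_).trans Finset.image_id
      obtain ⟨t, ht, rfl⟩ := mem_ratFinset.1 hx
      exact hfix t ht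
    have hfS : S.image ⇑f = ratFinset (y :: T) := by
      rw [ratFinset_cons, ← hferase, ← hfr, ← Finset.image_insert, Finset.insert_erase hr]
    have hcard' : (ratFinset (y :: T)).card = k + 1 := by
      rw [← hfS, Finset.card_image_of_injective _ f.injective, hcard]
    have hclique : IsClique (ratFinset (y :: T)) := hfS ▸ hS.image hfW
    have hnodup : ((y :: T).map toRat).Nodup := by
      refine List.nodup_cons.2 ⟨fun hmem => ?_,
        (nodup_cliqueReps k (by omega) T hT).map toRat_injective⟩
      have : f r ∈ (S.erase r).image ⇑f := by
        rw [hferase, hfr]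
        exact List.mem_toFinset.2 hmem
      obtain ⟨x, hx, hxr⟩ := Finset.mem_image.1 this
      exact Finset.ne_of_mem_erase hx (f.injective hxr)
    have hext : isExtension T y = true := by
      refine isExtension_of_isClique hnodup hclique ?_ fun a ha h => hyr ▸ hdom a ha h
      rw [← hfS, Finset.forall_mem_image, sum_image_apply, ← hfr]
      intro s hs
      rw [hfW.1, hfW.1]
      exact hmax s hs
    obtain ⟨p, hp, rfl⟩ := List.mem_map.1 hT
    obtain ⟨c, hc⟩ := exists_isLink (allLinked_cliqueData k (by omega) p hp) y
      (List.mem_filter.2 ⟨hy, hext⟩)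
    obtain ⟨T', hT', hsame⟩ := sameOrbit_of_isLink hc
      (fun x hx => hclique.1 _ (mem_ratFinset.2 ⟨x, hx, rfl⟩)) hcard'
    exact ⟨T', hT', SameOrbit.trans ⟨f, hfW, hfS⟩ hsame⟩

end Orbits

section Invariants

open Vec

/-- Four times the frame operator of `S`. -/
def ratFrame (S : Finset (Fin 8 → ℚ)) (v : Fin 8 → ℚ) : Fin 8 → ℚ :=
  ∑ s ∈ S, (4 * E8dot v s) • s

/-- Two rational numbers depending only on the orbit of `S`. -/
def ratInvariants (S : Finset (Fin 8 → ℚ)) : ℚ × ℚ :=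
  (∏ s ∈ S, 4 * E8dot (ratFrame S (ratFrame S s)) (ratFrame S (ratFrame S s)),
    ∑ r ∈ ratFinset rootList, ∏ s ∈ S, (4 * E8dot r s + 4))

theorem ratFrame_image {g : (Fin 8 → ℚ) ≃ₗ[ℚ] (Fin 8 → ℚ)} (hg : InW g)
    (S : Finset (Fin 8 → ℚ)) (v : Fin 8 → ℚ) :
    ratFrame (S.image ⇑g) (g v) = g (ratFrame S v) := by
  rw [ratFrame, Finset.sum_image g.injective.injOn, ratFrame, map_sum]
  simp only [hg.1, map_smul]

theorem image_ratFinset_rootList {g : (Fin 8 → ℚ) ≃ₗ[ℚ] (Fin 8 → ℚ)} (hg : InW g) :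
    (ratFinset rootList).image ⇑g = ratFinset rootList := by
  refine Finset.eq_of_subset_of_card_le ?_ (Finset.card_image_of_injective _ g.injective).ge
  rw [Finset.image_subset_iff]
  intro r hr
  exact mem_ratFinset_rootList.2 (hg.isE8Root_iff.2 (mem_ratFinset_rootList.1 hr))

theorem ratInvariants_image {g : (Fin 8 → ℚ) ≃ₗ[ℚ] (Fin 8 → ℚ)} (hg : InW g)
    (S : Finset (Fin 8 → ℚ)) : ratInvariants (S.image ⇑g) = ratInvariants S := by
  have h : ∀ f : (Fin 8 → ℚ) → ℚ, ∑ r ∈ ratFinset rootList, f r =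
      ∑ r ∈ ratFinset rootList, f (g r) := fun f => by
    conv_lhs => rw [← image_ratFinset_rootList hg, Finset.sum_image g.injective.injOn]
  rw [ratInvariants, h]
  simp only [Finset.prod_image g.injective.injOn, ratFrame_image hg, hg.1]
  rfl

theorem SameOrbit.ratInvariants_eq {S T : Finset (Fin 8 → ℚ)} (h : SameOrbit S T) :
    ratInvariants T = ratInvariants S := by
  obtain ⟨g, hg, rfl⟩ := h
  exact ratInvariants_image hg S

theorem toRat_frame {T : List Vec} (hT : T.Nodup) (v : Vec) :
    (frame T v).toRat = ratFrame (ratFinset T) v.toRat := by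
  rw [ratFrame, ratFinset, List.sum_toFinset _ (hT.map toRat_injective), List.map_map]
  clear hT
  induction T with
  | nil =>
    ext i
    fin_cases i <;> simp [frame, toRat]
  | cons t T ih =>
    rw [List.map_cons, List.sum_cons, ← ih, add_comm, Function.comp_apply, ← dot_cast,
      ← toRat_addMul]
    rfl

theorem ratInvariants_ratFinset {T : List Vec} (hT : T.Nodup) :
    ratInvariants (ratFinset T) = (((invariants T).1 : ℚ), ((invariants T).2 : ℚ)) := by
  have prod : ∀ f : (Fin 8 → ℚ) → ℚ, ∏ s ∈ ratFinset T, f s =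
      (T.map fun s => f s.toRat).prod := fun f => by
    rw [ratFinset, List.prod_toFinset _ (hT.map toRat_injective), List.map_map]
    rfl
  have sum : ∀ f : (Fin 8 → ℚ) → ℚ, ∑ s ∈ ratFinset rootList, f s =
      (rootList.map fun s => f s.toRat).sum := fun f => by
    rw [ratFinset, List.sum_toFinset _ (nodup_rootList.map toRat_injective), List.map_map]
    rfl
  simp only [ratInvariants, sum, prod, ← toRat_frame hT, ← dot_cast, invariants,
    Int.cast_list_sum, Int.cast_list_prod, List.map_map, Function.comp_def, Int.cast_add,
    Int.cast_ofNat]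

end Invariants

theorem isRootClique8_ratFinset {T : List Vec} (hT : T ∈ cliqueReps 8) :
    IsRootClique8 (ratFinset T) := by
  obtain ⟨hlen, hroot, hdot⟩ := clique_of_mem_cliqueReps T hT
  refine ⟨?_, fun r hr => ?_, fun r hr s hs hne => ?_⟩
  · rw [card_ratFinset (nodup_cliqueReps 8 le_rfl T hT), hlen]
  · obtain ⟨x, hx, rfl⟩ := mem_ratFinset.1 hr
    exact (isE8Root_toRat x).2 (hroot x hx)
  · obtain ⟨x, hx, rfl⟩ := mem_ratFinset.1 hr
    obtain ⟨y, hy, rfl⟩ := mem_ratFinset.1 hs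
    rw [E8dot_toRat]
    refine (hdot x hx y hy fun h => hne (h ▸ rfl)).imp (fun h => ?_) fun h => ?_ <;>
    · rw [h]
      norm_num

end E8

/-- The action of `W` on 8-element cliques of roots has exactly 47 orbits, expressed
by a system of 47 pairwise inequivalent representatives meeting every clique. -/
theorem weyl_orbits_of_cliques_of_size_eight :
    ∃ reps : Fin 47 → Finset (Fin 8 → ℚ),
      (∀ i, IsRootClique8 (reps i)) ∧
      (∀ i j, i ≠ j →
        ¬ ∃ g : (Fin 8 → ℚ) ≃ₗ[ℚ] (Fin 8 → ℚ), InW g ∧ (reps i).image ⇑g = reps j) ∧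
      (∀ S : Finset (Fin 8 → ℚ), IsRootClique8 S →
        ∃ i, ∃ g : (Fin 8 → ℚ) ≃ₗ[ℚ] (Fin 8 → ℚ), InW g ∧ S.image ⇑g = reps i) := by
  refine ⟨fun i => E8.ratFinset ((E8.cliqueReps 8).get (i.cast E8.length_cliqueReps.symm)),
    fun i => E8.isRootClique8_ratFinset (List.get_mem _ _), fun i j hij hg => hij ?_,
    fun S hS => ?_⟩
  · have h := E8.SameOrbit.ratInvariants_eq hg
    simp only [E8.ratInvariants_ratFinset (E8.nodup_cliqueReps 8 le_rfl _ (List.get_mem _ _)),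
      Prod.mk.injEq, Int.cast_inj] at h
    have hget := List.inj_on_of_nodup_map E8.nodup_invariants (List.get_mem _ _)
      (List.get_mem _ _) (Prod.ext h.1 h.2)
    exact (Fin.cast_injective _
      ((List.nodup_iff_injective_get.1 (E8.nodup_invariants.of_map _)) hget)).symm
  · obtain ⟨T, hT, h⟩ := E8.exists_rep 8 le_rfl S hS.2 hS.1
    obtain ⟨i, rfl⟩ := List.get_of_mem hT
    exact ⟨i.cast E8.length_cliqueReps, h⟩
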